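/- arXiv:math/0610775 — 5 statements merged into one kernel-verified Lean document; each statement's English description precedes it below -/
import Mathlib

section
/- For every integer m ≥ 1, every subset H ⊆ {1, …, m} and every real ε with 0 < ε < π/2, there exists a real sequence w_0, w_1, …, w_{m+1} with (w_0, w_1) = (ε, 2ε) and (w_m, w_{m+1}) = (2ε, ε), such that 0 < w_i < π for all 1 ≤ i ≤ m, and for every index i with 1 ≤ i ≤ m: |w_{i+1} − w_{i−1}| < w_i if i ∈ H, and w_{i+1} + w_{i−1} < 2w_i if i ∉ H. -/
open Real

/-- There is a strictly concave sequence vanishing at `1` and `m` whose values on `[1, m]` are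
nonnegative and smaller than any prescribed `δ > 0`. -/
theorem exists_small_strictly_concave_seq (m : ℕ) (δ : ℝ) (hδ : 0 < δ) :
    ∃ q : ℕ → ℝ, q 1 = 0 ∧ q m = 0 ∧ (∀ i, 1 ≤ i → i ≤ m → 0 ≤ q i ∧ q i < δ) ∧
      ∀ j, q (j + 2) + q j < 2 * q (j + 1) := by
  have hM : (0 : ℝ) < (m : ℝ) ^ 2 + 1 := by positivity
  set η : ℝ := δ / ((m : ℝ) ^ 2 + 1) with hη
  have hη0 : 0 < η := div_pos hδ hM
  have hηM : η * ((m : ℝ) ^ 2 + 1) = δ := div_mul_cancel₀ δ hM.ne'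
  refine ⟨fun i => η * (((i : ℝ) - 1) * ((m : ℝ) - i)), by simp, by simp, ?_, ?_⟩
  · intro i h1 h2
    have h1' : (1 : ℝ) ≤ i := by exact_mod_cast h1
    have h2' : (i : ℝ) ≤ m := by exact_mod_cast h2
    refine ⟨mul_nonneg hη0.le (mul_nonneg (by linarith) (by linarith)), ?_⟩
    rw [← hηM]
    exact mul_lt_mul_of_pos_left (by nlinarith) hη0
  · intro j
    push_cast
    nlinarith

theorem stmt4 (m : ℕ) (hm : 1 ≤ m) (H : Set ℕ) (hH : H ⊆ Set.Icc 1 m)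
    (ε : ℝ) (hε : 0 < ε) (hε' : ε < π / 2) :
    ∃ w : ℕ → ℝ, w 0 = ε ∧ w 1 = 2 * ε ∧ w m = 2 * ε ∧ w (m + 1) = ε ∧
      (∀ i, 1 ≤ i → i ≤ m → 0 < w i ∧ w i < π) ∧
      (∀ i, 1 ≤ i → i ≤ m →
        (i ∈ H → |w (i + 1) - w (i - 1)| < w i) ∧
        (i ∉ H → w (i + 1) + w (i - 1) < 2 * w i)) := by
  obtain ⟨q, hq1, hqm, hq, hconc⟩ := exists_small_strictly_concave_seq m (min ε (π - 2 * ε))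
    (lt_min hε (by linarith))
  set w : ℕ → ℝ := fun i => if i = 0 ∨ i = m + 1 then ε else 2 * ε + q i with hw
  have w0 : w 0 = ε := by simp [hw]
  have wlast : w (m + 1) = ε := by simp [hw]
  have wmid : ∀ i, 1 ≤ i → i ≤ m → w i = 2 * ε + q i := fun i h1 h2 =>
    if_neg (by omega)
  have hb : ∀ i, 1 ≤ i → i ≤ m → 0 ≤ q i ∧ q i < ε ∧ q i < π - 2 * ε := fun i h1 h2 =>
    ⟨(hq i h1 h2).1, lt_min_iff.1 (hq i h1 h2).2⟩
  refine ⟨w, w0, by rw [wmid 1 le_rfl hm, hq1, add_zero], by rw [wmid m hm le_rfl, hqm, add_zero],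
    wlast, ?_, ?_⟩
  · intro i h1 h2
    obtain ⟨ha, hb, hc⟩ := hb i h1 h2
    rw [wmid i h1 h2]
    constructor <;> linarith
  · intro i h1 h2
    suffices |w (i + 1) - w (i - 1)| < w i ∧ w (i + 1) + w (i - 1) < 2 * w i from
      ⟨fun _ => this.1, fun _ => this.2⟩
    obtain ⟨j, rfl⟩ : ∃ j, i = j + 1 := ⟨i - 1, by omega⟩
    have hi := hb (j + 1) h1 h2
    have hcj := hconc j
    rw [Nat.add_sub_cancel, wmid (j + 1) h1 h2, abs_lt]
    rcases Nat.eq_zero_or_pos j with rfl | hj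
    · rw [w0]
      rcases h2.eq_or_lt with h | h
      · rw [h, wlast, ← h]
        refine ⟨⟨?_, ?_⟩, ?_⟩ <;> linarith
      · have hn := hb (0 + 1 + 1) (by omega) h
        rw [wmid (0 + 1 + 1) (by omega) h]
        refine ⟨⟨?_, ?_⟩, ?_⟩ <;> linarith
    · have hp := hb j hj (by omega)
      rw [wmid j hj (by omega)]
      rcases h2.eq_or_lt with h | h
      · rw [h, wlast, ← h]
        refine ⟨⟨?_, ?_⟩, ?_⟩ <;> linarith
      · have hn := hb (j + 1 + 1) (by omega) h
        rw [wmid (j + 1 + 1) (by omega) h]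
        refine ⟨⟨?_, ?_⟩, ?_⟩ <;> linarith
end

section
/- Let m ≥ 1 be an integer, H ⊆ {1, …, m−1}, and let v, v' : {0, …, m} → ℝ with v'_0 = v_0 and v'_1 = v_1. Assume that for every i ∈ {1, …, m−1}: if i ∉ H then v_{i+1} + v_{i−1} = 2v_i and v'_{i+1} + v'_{i−1} ≤ 2v'_i, while if i ∈ H then v_{i+1} = v_i + v_{i−1} and |v'_{i+1} − v'_{i−1}| ≤ v'_i. Then v'_i ≤ v_i and v'_i − v'_{i−1} ≤ v_i − v_{i−1} for all 1 ≤ i ≤ m. -/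
open Real

theorem stmt5 (m : ℕ) (hm : 1 ≤ m) (H : Set ℕ) (hH : H ⊆ Set.Icc 1 (m - 1))
    (v v' : ℕ → ℝ) (h0 : v' 0 = v 0) (h1 : v' 1 = v 1)
    (hrec : ∀ i, 1 ≤ i → i ≤ m - 1 →
      (i ∉ H → v (i + 1) + v (i - 1) = 2 * v i ∧
        v' (i + 1) + v' (i - 1) ≤ 2 * v' i) ∧
      (i ∈ H → v (i + 1) = v i + v (i - 1) ∧
        |v' (i + 1) - v' (i - 1)| ≤ v' i)) :
    ∀ i, 1 ≤ i → i ≤ m → v' i ≤ v i ∧ v' i - v' (i - 1) ≤ v i - v (i - 1) := by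
  have key : ∀ n, n + 1 ≤ m →
      v' n ≤ v n ∧ v' (n + 1) ≤ v (n + 1) ∧ v' (n + 1) - v' n ≤ v (n + 1) - v n := by
    intro n
    induction n with
    | zero =>
      intro _
      simp [h0, h1]
    | succ k ih =>
      intro hk
      obtain ⟨hv, hv_succ, hinc⟩ := ih (by omega)
      obtain ⟨hflat, hhinge⟩ := hrec (k + 1) (by omega) (by omega)
      rw [Nat.add_sub_cancel] at hflat hhinge
      by_cases hmem : k + 1 ∈ H
      · obtain ⟨heq, habs⟩ := hhinge hmem
        have hle := (abs_le.mp habs).2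
        exact ⟨hv_succ, by linarith, by linarith⟩
      · obtain ⟨heq, hle⟩ := hflat hmem
        exact ⟨hv_succ, by linarith, by linarith⟩
  intro i hi him
  obtain ⟨n, rfl⟩ := Nat.exists_eq_add_of_le' hi
  exact (key n him).2
end

section
/- Let m ≥ 2 be an integer, H ⊆ {1, …, m−1}, and let v, v' : {0, …, m} → ℝ with v'_0 = v_0 and v'_1 = v_1. Assume that for every i ∈ {1, …, m−1}: if i ∉ H then v_{i+1} + v_{i−1} = 2v_i and v'_{i+1} + v'_{i−1} < 2v'_i, while if i ∈ H then v_{i+1} = v_i + v_{i−1} and |v'_{i+1} − v'_{i−1}| < v'_i. Then v'_i < v_i for all 2 ≤ i ≤ m; in particular v'_m < v_m. -/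
open Real

theorem stmt6 (m : ℕ) (hm : 2 ≤ m) (H : Set ℕ) (hH : H ⊆ Set.Icc 1 (m - 1))
    (v v' : ℕ → ℝ) (h0 : v' 0 = v 0) (h1 : v' 1 = v 1)
    (hrec : ∀ i, 1 ≤ i → i ≤ m - 1 →
      (i ∉ H → v (i + 1) + v (i - 1) = 2 * v i ∧
        v' (i + 1) + v' (i - 1) < 2 * v' i) ∧
      (i ∈ H → v (i + 1) = v i + v (i - 1) ∧
        |v' (i + 1) - v' (i - 1)| < v' i)) :
    ∀ i, 2 ≤ i → i ≤ m → v' i < v i := by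
  have step : ∀ i, 1 ≤ i → i ≤ m - 1 → 0 ≤ v (i - 1) - v' (i - 1) →
      v (i - 1) - v' (i - 1) ≤ v i - v' i → v i - v' i < v (i + 1) - v' (i + 1) := by
    intro i hi him hnonneg hmono
    by_cases hiH : i ∈ H
    · obtain ⟨hv, hv'⟩ := (hrec i hi him).2 hiH
      linarith [(abs_lt.mp hv').2]
    · obtain ⟨hv, hv'⟩ := (hrec i hi him).1 hiH
      linarith
  have key : ∀ k, k + 1 ≤ m → 0 ≤ v k - v' k ∧ v k - v' k ≤ v (k + 1) - v' (k + 1) := by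
    intro k
    induction k with
    | zero => intro _; constructor <;> simp [h0, h1]
    | succ k ih =>
      intro hk
      obtain ⟨hnonneg, hmono⟩ := ih (by omega)
      exact ⟨hnonneg.trans hmono, (step (k + 1) (by omega) (by omega) hnonneg hmono).le⟩
  intro i hi him
  obtain ⟨k, rfl⟩ := Nat.exists_eq_add_of_le' hi
  obtain ⟨hnonneg, hmono⟩ := key k (by omega)
  have hlt := step (k + 1) (by omega) (by omega) hnonneg hmono
  linarith
end

section
/- Let m ≥ 2 be an integer and H ⊆ {1, …, m−1}. Define sequences α, β : {0, …, m} → ℝ by (α_0, α_1) = (0, 1), (β_0, β_1) = (1, 1), and for 1 ≤ i ≤ m−1: α_{i+1} = 2α_i − α_{i−1} and β_{i+1} = 2β_i − β_{i−1} if i ∉ H, while α_{i+1} = α_i + α_{i−1} and β_{i+1} = β_i + β_{i−1} if i ∈ H. Let a, b be reals with 0 ≤ a < π, 0 ≤ b < π and 0 < a + b ≤ π. Then the following are equivalent: (1) there exists a real sequence w_0, …, w_m with w_0 = a, w_1 = a + b, w_m = π, with 0 < w_i < π for all 1 ≤ i ≤ m−1, and satisfying for every 1 ≤ i ≤ m−1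 the strict conditions |w_{i+1} − w_{i−1}| < w_i if i ∈ H and w_{i+1} + w_{i−1} < 2w_i if i ∉ H; (2) a·β_m + b·α_m > π > a + b. -/
open Real

open Classical in
/-- One step of the extremal recursion: additive at a hinge, affine otherwise. -/
noncomputable def hingeStep (c : Prop) (p q : ℝ) : ℝ :=
  if c then q + p else 2 * q - p

/-- The last term of the extremal sequence starting with `p, q` after `n` further steps. -/
noncomputable def extremalEnd : (ℕ → Prop) → ℕ → ℝ → ℝ → ℝ
  | _, 0, _, q => q
  | h, n + 1, p, q => extremalEnd (fun j => h (j + 1)) n q (hingeStep (h 0) p q)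

/-- The strict inequality at the middle of three consecutive terms. -/
def HingeCond (c : Prop) (x y z : ℝ) : Prop :=
  (c → |z - x| < y) ∧ (¬ c → z + x < 2 * y)

/-- The pair `p, q` extends to an admissible sequence reaching `π` after `n` further steps. -/
def Extends (h : ℕ → Prop) (n : ℕ) (p q : ℝ) : Prop :=
  ∃ w : ℕ → ℝ, w 0 = p ∧ w 1 = q ∧ w (n + 1) = π ∧
    ∀ j < n, (0 < w (j + 1) ∧ w (j + 1) < π) ∧ HingeCond (h j) (w j) (w (j + 1)) (w (j + 2))

lemma le_hingeStep (c : Prop) {p q : ℝ} (hp : 0 ≤ p) (hpq : p ≤ q) : q ≤ hingeStep c p q := by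
  unfold hingeStep
  split_ifs <;> linarith

lemma continuous_hingeStep (c : Prop) : Continuous fun z : ℝ × ℝ => hingeStep c z.1 z.2 := by
  unfold hingeStep
  split_ifs <;> fun_prop

lemma continuous_extremalEnd (h : ℕ → Prop) (n : ℕ) :
    Continuous fun z : ℝ × ℝ => extremalEnd h n z.1 z.2 := by
  induction n generalizing h with
  | zero => exact continuous_snd
  | succ n ih =>
    exact (ih fun j => h (j + 1)).comp (continuous_snd.prodMk (continuous_hingeStep (h 0)))

lemma le_extremalEnd (h : ℕ → Prop) (n : ℕ) {p q : ℝ} (hp : 0 ≤ p) (hpq : p ≤ q) :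
    q ≤ extremalEnd h n p q := by
  induction n generalizing h p q with
  | zero => exact le_rfl
  | succ n ih =>
    have hs := le_hingeStep (h 0) hp hpq
    exact hs.trans (ih _ (hp.trans hpq) hs)

lemma lt_extremalEnd_succ (h : ℕ → Prop) (n : ℕ) {p q : ℝ} (hp : 0 < p) (hpq : p < q) :
    q < extremalEnd h (n + 1) p q := by
  have hs : q < hingeStep (h 0) p q := by
    unfold hingeStep
    split_ifs <;> linarith
  exact hs.trans_le (le_extremalEnd _ n (hp.trans hpq).le hs.le)

lemma extremalEnd_eq (h : ℕ → Prop) (n : ℕ) (x : ℕ → ℝ)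
    (hx : ∀ j < n, x (j + 2) = hingeStep (h j) (x j) (x (j + 1))) :
    extremalEnd h n (x 0) (x 1) = x (n + 1) := by
  induction n generalizing h x with
  | zero => rfl
  | succ n ih =>
    have := ih (fun j => h (j + 1)) (fun j => x (j + 1)) fun j hj => hx (j + 1) (by omega)
    simpa [extremalEnd, hx 0 (by omega)] using this

lemma HingeCond.lt_hingeStep {c : Prop} {x y z : ℝ} (hc : HingeCond c x y z) :
    z < hingeStep c x y := by
  unfold hingeStep
  split_ifs with h
  · linarith [(abs_lt.1 (hc.1 h)).2]
  · linarith [hc.2 h]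

lemma hingeCond_of_lt {c : Prop} {x y z : ℝ} (hz : z < hingeStep c x y) (hx : x < y + z) :
    HingeCond c x y z := by
  unfold hingeStep at hz
  refine ⟨fun h => ?_, fun h => ?_⟩
  · rw [if_pos h] at hz
    exact abs_lt.2 ⟨by linarith, by linarith⟩
  · rw [if_neg h] at hz
    linarith

lemma Extends.cons {h : ℕ → Prop} {n : ℕ} {p q r : ℝ}
    (hw : Extends (fun j => h (j + 1)) n q r) (hq : 0 < q) (hqπ : q < π)
    (hc : HingeCond (h 0) p q r) : Extends h (n + 1) p q := by
  obtain ⟨w, h0, h1, hπ, hw⟩ := hw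
  refine ⟨fun j => Nat.casesOn j p w, rfl, h0, hπ, fun j hj => ?_⟩
  cases j with
  | zero => simpa [h0, h1] using ⟨⟨hq, hqπ⟩, hc⟩
  | succ j => exact hw j (by omega)

lemma extends_zero (h : ℕ → Prop) (p : ℝ) : Extends h 0 p π :=
  ⟨fun j => Nat.casesOn j p fun _ => π, rfl, rfl, rfl, fun _ hj => absurd hj (by omega)⟩

lemma eventually_extends_cons {h : ℕ → Prop} {n : ℕ} {p q r : ℝ} (hq : 0 < q) (hqπ : q < π)
    (hr : r < hingeStep (h 0) p q) (hp : p < q + r)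
    (hw : ∀ᶠ y in nhds q, Extends (fun j => h (j + 1)) n y r) :
    ∀ᶠ z in nhds (p, q), Extends h (n + 1) z.1 z.2 := by
  have hsnd : Filter.Tendsto (fun z : ℝ × ℝ => z.2) (nhds (p, q)) (nhds q) :=
    continuous_snd.tendsto _
  have hlt : ∀ᶠ z : ℝ × ℝ in nhds (p, q), z.1 < z.2 + r :=
    (isOpen_lt continuous_fst (continuous_snd.add continuous_const)).mem_nhds hp
  filter_upwards [hsnd.eventually hw, hsnd.eventually (lt_mem_nhds hq),
    hsnd.eventually (gt_mem_nhds hqπ), hlt,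
    ((continuous_hingeStep (h 0)).tendsto (p, q)).eventually (lt_mem_nhds hr)]
    with z h1 h2 h3 h4 h5
  exact h1.cons h2 h3 (hingeCond_of_lt h5 h4)

lemma eventually_extends (h : ℕ → Prop) (n : ℕ) {p q : ℝ} (hp : 0 ≤ p) (hpq : p ≤ q)
    (hq : 0 < q) (hqπ : q < π) (hend : π < extremalEnd h n p q) :
    ∀ᶠ z in nhds (p, q), Extends h n z.1 z.2 := by
  induction n generalizing h p q with
  | zero => exact absurd hend hqπ.not_gt
  | succ n ih =>
    set s := hingeStep (h 0) p q with hs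
    have hqs : q ≤ s := le_hingeStep _ hp hpq
    rcases n with _ | n
    · exact eventually_extends_cons hq hqπ hend (by linarith)
        (Filter.Eventually.of_forall fun y => extends_zero _ y)
    suffices ∃ r, r < s ∧ 0 < r ∧ ∀ᶠ z in nhds (q, r),
        Extends (fun j => h (j + 1)) (n + 1) z.1 z.2 by
      obtain ⟨r, hrs, hr, hw⟩ := this
      exact eventually_extends_cons hq hqπ hrs (by linarith)
        ((continuous_id.prodMk continuous_const).tendsto' q (q, r) rfl |>.eventually hw)
    have hcont : ∀ t : ℝ, Filter.Tendsto (fun r : ℝ => (q, r)) (nhdsWithin t (Set.Iio t))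
        (nhds (q, t)) := fun t =>
      ((continuous_const.prodMk continuous_id).tendsto' t (q, t) rfl).mono_left
        nhdsWithin_le_nhds
    have hmem : ∀ t : ℝ, ∀ᶠ r in nhdsWithin t (Set.Iio t), r < t := fun _ =>
      self_mem_nhdsWithin
    rcases lt_or_ge s π with hsπ | hsπ
    · have hw := ih (fun j => h (j + 1)) hq.le hqs (hq.trans_le hqs) hsπ hend
      have hpos : ∀ᶠ r in nhdsWithin s (Set.Iio s), 0 < r :=
        nhdsWithin_le_nhds (lt_mem_nhds (hq.trans_le hqs))
      obtain ⟨r, hr1, hr2, hr3⟩ :=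
        ((hmem s).and (hpos.and ((hcont s).eventually hw.eventually_nhds))).exists
      exact ⟨r, hr1, hr2, hr3⟩
    · have hπ : π < extremalEnd (fun j => h (j + 1)) (n + 1) q π :=
        lt_extremalEnd_succ _ n hq hqπ
      have hlim := (continuous_extremalEnd (fun j => h (j + 1)) (n + 1)).tendsto (q, π)
      have hgt : ∀ᶠ r in nhdsWithin π (Set.Iio π), q < r :=
        nhdsWithin_le_nhds (lt_mem_nhds hqπ)
      obtain ⟨r, hr1, hr2, hr3⟩ := ((hmem π).and
        (hgt.and ((hlim.comp (hcont π)).eventually (lt_mem_nhds hπ)))).exists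
      exact ⟨r, lt_of_lt_of_le hr1 hsπ, hq.trans hr2,
        ih (fun j => h (j + 1)) hq.le hr2.le (hq.trans hr2) hr1 hr3⟩

lemma lt_of_hingeCond (h : ℕ → Prop) (n : ℕ) (x w : ℕ → ℝ) (h0 : w 0 = x 0) (h1 : w 1 = x 1)
    (hx : ∀ j < n + 1, x (j + 2) = hingeStep (h j) (x j) (x (j + 1)))
    (hw : ∀ j < n + 1, HingeCond (h j) (w j) (w (j + 1)) (w (j + 2))) :
    w (n + 2) < x (n + 2) := by
  have key : ∀ j ≤ n + 1, 0 ≤ x j - w j ∧ x j - w j ≤ x (j + 1) - w (j + 1) := by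
    intro j hj
    induction j with
    | zero => constructor <;> simp [h0, h1]
    | succ j ih =>
      obtain ⟨ih1, ih2⟩ := ih (by omega)
      refine ⟨ih1.trans ih2, ?_⟩
      have hlt := (hw j (by omega)).lt_hingeStep
      rw [hx j (by omega)]
      unfold hingeStep at hlt ⊢
      split_ifs at hlt ⊢ <;> linarith
  obtain ⟨k1, k2⟩ := key n (by omega)
  have hlt := (hw n (by omega)).lt_hingeStep
  rw [hx n (by omega)]
  unfold hingeStep at hlt ⊢
  split_ifs at hlt ⊢ <;> linarith

theorem stmt8 (m : ℕ) (hm : 2 ≤ m) (H : Set ℕ) (hH : H ⊆ Set.Icc 1 (m - 1))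
    (α β : ℕ → ℝ)
    (hα0 : α 0 = 0) (hα1 : α 1 = 1) (hβ0 : β 0 = 1) (hβ1 : β 1 = 1)
    (hrec : ∀ i, 1 ≤ i → i ≤ m - 1 →
      (i ∉ H → α (i + 1) = 2 * α i - α (i - 1) ∧
        β (i + 1) = 2 * β i - β (i - 1)) ∧
      (i ∈ H → α (i + 1) = α i + α (i - 1) ∧
        β (i + 1) = β i + β (i - 1)))
    (a b : ℝ) (ha0 : 0 ≤ a) (ha1 : a < π) (hb0 : 0 ≤ b) (hb1 : b < π)
    (hab0 : 0 < a + b) (hab1 : a + b ≤ π) :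
    (∃ w : ℕ → ℝ, w 0 = a ∧ w 1 = a + b ∧ w m = π ∧
      (∀ i, 1 ≤ i → i ≤ m - 1 → 0 < w i ∧ w i < π) ∧
      (∀ i, 1 ≤ i → i ≤ m - 1 →
        (i ∈ H → |w (i + 1) - w (i - 1)| < w i) ∧
        (i ∉ H → w (i + 1) + w (i - 1) < 2 * w i)))
    ↔ (a * β m + b * α m > π ∧ π > a + b) := by
  obtain ⟨n, rfl⟩ : ∃ n, m = n + 2 := ⟨m - 2, by omega⟩
  set x : ℕ → ℝ := fun i => a * β i + b * α i with hxdef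
  have hx0 : x 0 = a := by simp [hxdef, hα0, hβ0]
  have hx1 : x 1 = a + b := by simp [hxdef, hα1, hβ1]
  have hx : ∀ j < n + 1, x (j + 2) = hingeStep (j + 1 ∈ H) (x j) (x (j + 1)) := by
    intro j hj
    have hr := hrec (j + 1) (by omega) (by omega)
    simp only [Nat.add_sub_cancel] at hr
    unfold hingeStep
    split_ifs with hjH
    · obtain ⟨e1, e2⟩ := hr.2 hjH
      simp only [hxdef, e1, e2]
      ring
    · obtain ⟨e1, e2⟩ := hr.1 hjH
      simp only [hxdef, e1, e2]
      ring
  constructor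
  · rintro ⟨w, h0, h1, hπ, hrange, hcond⟩
    refine ⟨?_, ?_⟩
    · have := lt_of_hingeCond (fun j => j + 1 ∈ H) n x w (h0.trans hx0.symm)
        (h1.trans hx1.symm) hx fun j hj => hcond (j + 1) (by omega) (by omega)
      rwa [hπ] at this
    · rw [← h1]
      exact (hrange 1 le_rfl (by omega)).2
  · rintro ⟨hend, hlt⟩
    have he := extremalEnd_eq (fun j => j + 1 ∈ H) (n + 1) x hx
    rw [hx0, hx1] at he
    obtain ⟨w, h0, h1, hπ, hw⟩ := (eventually_extends (fun j => j + 1 ∈ H) (n + 1) ha0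
      (by linarith) hab0 hlt (he ▸ hend)).self_of_nhds
    refine ⟨w, h0, h1, hπ, fun i hi him => ?_, fun i hi him => ?_⟩
    · obtain ⟨j, rfl⟩ : ∃ j, i = j + 1 := ⟨i - 1, by omega⟩
      exact (hw j (by omega)).1
    · obtain ⟨j, rfl⟩ : ∃ j, i = j + 1 := ⟨i - 1, by omega⟩
      exact (hw j (by omega)).2
end

section
/- Let x_1, x_2, x_3 be integers with x_i ≥ 2 for all i and at most one x_i equal to 2, and let y_1, y_2, y_3 be integers with 1 ≤ y_i ≤ x_i − 1. Assume 1/x_1 + 1/x_2 + 1/x_3 ≥ 1 and that y_i ≥ 2 for at least one index i. Then there exist positive real numbers α_1, α_2, α_3, β_1, β_2, β_3 such that (taking indices modulo 3): α_i = β_i whenever x_i = 2; α_i > β_i whenever x_i > 2; (x_i − 1)·β_i > α_i whenever x_i > 2 and y_i = 1; and α_i > β_{i+1} + β_{i+2} for every i. -/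
open Real

theorem stmt10 (x y : ZMod 3 → ℤ)
    (hx : ∀ i, 2 ≤ x i)
    (hx2 : ∀ i j, x i = 2 → x j = 2 → i = j)
    (hy : ∀ i, 1 ≤ y i ∧ y i ≤ x i - 1)
    (hsum : (1 : ℝ) / (x 0 : ℝ) + 1 / (x 1 : ℝ) + 1 / (x 2 : ℝ) ≥ 1)
    (hy2 : ∃ i, 2 ≤ y i) :
    ∃ α β : ZMod 3 → ℝ,
      (∀ i, 0 < α i) ∧ (∀ i, 0 < β i) ∧
      (∀ i, x i = 2 → α i = β i) ∧
      (∀ i, 2 < x i → β i < α i) ∧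
      (∀ i, 2 < x i → y i = 1 → α i < ((x i : ℝ) - 1) * β i) ∧
      (∀ i, β (i + 1) + β (i + 2) < α i) := by
  obtain ⟨k, hk⟩ := hy2
  have hxk : 2 < x k := by have := (hy k).2; omega
  have cast_le : ∀ i, 2 < x i → (3 : ℝ) ≤ x i := fun i hi => by exact_mod_cast hi
  refine ⟨fun i => if i = k then 100 else if x i = 2 then 6 else 15 / 2,
    fun i => if i = k then 1 else if x i = 2 then 6 else 4, ?_, ?_, ?_, ?_, ?_, ?_⟩
  · intro i
    dsimp only
    split_ifs <;> norm_num
  · intro i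
    dsimp only
    split_ifs <;> norm_num
  · intro i hi
    have hik : i ≠ k := by rintro rfl; omega
    simp [hik, hi]
  · intro i hi
    dsimp only
    split_ifs <;> first | omega | norm_num
  · intro i hi hyi
    have hik : i ≠ k := by rintro rfl; omega
    have := cast_le i hi
    simp only [hik, hi.ne', if_false]
    linarith
  · intro i
    have h1 : i + 1 ≠ i := by revert i; decide
    have h2 : i + 2 ≠ i := by revert i; decide
    have h12 : i + 1 ≠ i + 2 := by revert i; decide
    have hcover : k = i ∨ k = i + 1 ∨ k = i + 2 := by
      clear h1 h2 h12 hxk hk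
      revert i k
      decide
    have n1 := fun h h' => h1 (hx2 (i + 1) i h h')
    have n2 := fun h h' => h2 (hx2 (i + 2) i h h')
    rcases hcover with rfl | rfl | rfl
    · simp only [h1, h2, if_true, if_false]
      split_ifs <;> norm_num
    · simp only [h1.symm, h12.symm, if_true, if_false]
      split_ifs <;> first | (exfalso; tauto) | norm_num
    · simp only [h2.symm, h12, if_true, if_false]
      split_ifs <;> first | (exfalso; tauto) | norm_num
end
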